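/- Let M ≥ 0 be a fixed natural number and x a real number. Then arctan(x) = lim_{L→∞} Σ_{ℓ=1}^{L} Σ_{m=0}^{M} ( ((-1)^m + 1) / ( (2L)^(m+1) (m+1)! ) ) · [ ∂^m/∂t^m ( x / (1 + x² t²) ) evaluated at t = (ℓ - 1/2)/L ], where the limit is taken over positive integers L. -/

import Mathlib

open Filter Topology

/-- Midpoint Riemann sums of a continuous function on `[0, 1]` converge to its integral. -/
theorem tendsto_midpoint_sum {f : ℝ → ℝ} (hf : Continuous f) :
    Tendsto (fun L : ℕ => (L : ℝ)⁻¹ * ∑ ℓ ∈ Finset.Icc 1 L, f (((ℓ : ℝ) - 1 / 2) / (L : ℝ)))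
      atTop (𝓝 (∫ t in (0 : ℝ)..1, f t)) := by
  have huc : UniformContinuousOn f (Set.Icc 0 1) :=
    isCompact_Icc.uniformContinuousOn_of_continuous hf.continuousOn
  rw [Metric.uniformContinuousOn_iff] at huc
  rw [Metric.tendsto_atTop]
  intro ε hε
  obtain ⟨δ, hδ, h⟩ := huc (ε / 2) (half_pos hε)
  obtain ⟨N, hN⟩ := exists_nat_gt δ⁻¹
  refine ⟨N + 1, fun L hL => ?_⟩
  have hLN : (N : ℝ) + 1 ≤ L := by exact_mod_cast hL
  have hL0 : (0 : ℝ) < L := by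
    have : (0 : ℝ) ≤ N := N.cast_nonneg
    linarith
  have hLδ : (L : ℝ)⁻¹ < δ := inv_lt_of_inv_lt₀ hδ (by linarith)
  have hsum : ∑ ℓ ∈ Finset.Icc 1 L, f (((ℓ : ℝ) - 1 / 2) / (L : ℝ)) =
      ∑ k ∈ Finset.range L, f (((k : ℝ) + 1 / 2) / (L : ℝ)) := by
    rw [Finset.range_eq_Ico, ← Finset.Ico_add_one_right_eq_Icc,
      ← Finset.sum_Ico_add' _ 0 L 1]
    refine Finset.sum_congr rfl fun k _ => ?_
    push_cast
    ring_nf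
  have hint : ∫ t in (0 : ℝ)..1, f t =
      ∑ k ∈ Finset.range L, ∫ t in ((k : ℝ) / L)..((k + 1 : ℕ) / L : ℝ), f t := by
    rw [intervalIntegral.sum_integral_adjacent_intervals (a := fun k : ℕ => (k : ℝ) / L)
      fun k _ => hf.intervalIntegrable _ _]
    simp [hL0.ne']
  have hterm : ∀ k ∈ Finset.range L,
      ‖(L : ℝ)⁻¹ * f (((k : ℝ) + 1 / 2) / L) -
        ∫ t in ((k : ℝ) / L)..((k + 1 : ℕ) / L : ℝ), f t‖ ≤ ε / 2 * (L : ℝ)⁻¹ := by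
    intro k hk
    have hkL : (k : ℝ) + 1 ≤ L := by exact_mod_cast Finset.mem_range.mp hk
    have hk0 : (0 : ℝ) ≤ k := k.cast_nonneg
    have hlen : ((k + 1 : ℕ) / L : ℝ) - k / L = (L : ℝ)⁻¹ := by
      push_cast
      field_simp
      ring
    have hconst : (L : ℝ)⁻¹ * f (((k : ℝ) + 1 / 2) / L) =
        ∫ _ in ((k : ℝ) / L)..((k + 1 : ℕ) / L : ℝ), f (((k : ℝ) + 1 / 2) / L) := by
      rw [intervalIntegral.integral_const, hlen, smul_eq_mul]
    rw [hconst, ← intervalIntegral.integral_sub (by simp) (hf.intervalIntegrable _ _)]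
    have hle : (k / L : ℝ) ≤ (k + 1 : ℕ) / L := by
      have := inv_pos.mpr hL0
      linarith
    refine (intervalIntegral.norm_integral_le_of_norm_le_const (C := ε / 2) fun t ht => ?_).trans
      (by rw [hlen, abs_of_pos (inv_pos.mpr hL0)])
    rw [Set.uIoc_of_le hle] at ht
    have hmid₁ : (k / L : ℝ) ≤ ((k : ℝ) + 1 / 2) / L := by gcongr; linarith
    have hmid₂ : ((k : ℝ) + 1 / 2) / L ≤ (k + 1 : ℕ) / L := by
      push_cast
      gcongr
      norm_num
    have hlow : (0 : ℝ) ≤ k / L := by positivity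
    have hupp : ((k + 1 : ℕ) / L : ℝ) ≤ 1 := by
      rw [div_le_one hL0]
      exact_mod_cast hkL
    have hdist : dist (((k : ℝ) + 1 / 2) / L) t < δ := by
      rw [Real.dist_eq, abs_lt]
      constructor <;> linarith [ht.1, ht.2]
    exact (h _ ⟨by linarith, by linarith⟩ t ⟨by linarith [ht.1], by linarith [ht.2]⟩ hdist).le
  rw [hsum, hint, dist_eq_norm, Finset.mul_sum, ← Finset.sum_sub_distrib]
  calc _ ≤ ∑ _k ∈ Finset.range L, ε / 2 * (L : ℝ)⁻¹ := norm_sum_le_of_le _ hterm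
    _ = ε / 2 := by
      rw [Finset.sum_const, Finset.card_range, nsmul_eq_mul]
      field_simp
    _ < ε := half_lt_self hε

theorem integral_div_one_add_sq_mul_sq (x : ℝ) :
    ∫ t in (0 : ℝ)..1, x / (1 + x ^ 2 * t ^ 2) = Real.arctan x := by
  have hderiv (t : ℝ) :
      HasDerivAt (fun t => Real.arctan (x * t)) (x / (1 + x ^ 2 * t ^ 2)) t := by
    convert (hasDerivAt_const_mul (x := t) x).arctan using 1
    ring
  have hcont : Continuous fun t : ℝ => x / (1 + x ^ 2 * t ^ 2) :=
    continuous_const.div (by fun_prop) fun t => by positivity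
  rw [intervalIntegral.integral_eq_sub_of_hasDerivAt (fun t _ => hderiv t)
    (hcont.intervalIntegrable _ _)]
  simp

theorem contDiff_div_one_add_sq_mul_sq (x : ℝ) (n : ℕ) :
    ContDiff ℝ n fun t : ℝ => x / (1 + x ^ 2 * t ^ 2) :=
  contDiff_const.div (by fun_prop) fun t => by positivity

theorem arctan_eq_lim_all_derivs (M : ℕ) (x : ℝ) :
    Tendsto
      (fun L : ℕ =>
        ∑ ℓ ∈ Finset.Icc 1 L, ∑ m ∈ Finset.range (M + 1),
          (((-1 : ℝ) ^ m + 1) / ((2 * (L : ℝ)) ^ (m + 1) * ((m + 1).factorial : ℝ))) *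
            iteratedDeriv m (fun t : ℝ => x / (1 + x ^ 2 * t ^ 2))
              (((ℓ : ℝ) - 1 / 2) / (L : ℝ)))
      atTop (𝓝 (Real.arctan x)) := by
  have hlim (m : ℕ) := (((tendsto_inv_atTop_nhds_zero_nat (𝕜 := ℝ)).pow m).mul
    (tendsto_midpoint_sum
      ((contDiff_div_one_add_sq_mul_sq x m).continuous_iteratedDeriv m le_rfl))).const_mul
    (((-1 : ℝ) ^ m + 1) / (2 ^ (m + 1) * ((m + 1).factorial : ℝ)))
  have h := tendsto_finsetSum (Finset.range (M + 1)) fun m _ => hlim m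
  convert h using 2 with L
  · rw [Finset.sum_comm]
    refine Finset.sum_congr rfl fun m _ => ?_
    rw [← Finset.mul_sum, ← mul_assoc, ← mul_assoc]
    congr 1
    rw [mul_pow, pow_succ (L : ℝ)]
    simp only [div_eq_mul_inv, mul_inv, inv_pow]
    ring
  · rw [Finset.sum_range_succ', Finset.sum_eq_zero fun m _ => by simp]
    simp [integral_div_one_add_sq_mul_sq]
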